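/- (Second-moment bound on the variance-reduced gradient estimator of Compositional-SVRG-1, eq. (26), pointwise form) For all x, x̃ ∈ ℝ^N, all g ∈ ℝ^M, and all i ∈ {1,…,n}, j ∈ {1,…,m}: ‖(∂G_j(x))^⊤ ∇F_i(g) − (∂G_j(x̃))^⊤ ∇F_i(G(x̃)) + ∇f(x̃)‖² ≤ 2 ‖∇f(x̃)‖² + 4 B_G² L_F² ‖g − G(x)‖² + 4 L_f² ‖x − x̃‖². -/

import Mathlib

open MeasureTheory ProbabilityTheory
open scoped BigOperators RealInnerProductSpace ENNReal

noncomputable section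

/-- `G(x) = (1/m) ∑ⱼ Gⱼ(x)`. -/
def Gbar {N M m : ℕ} (Gc : Fin m → EuclideanSpace ℝ (Fin N) → EuclideanSpace ℝ (Fin M))
    (x : EuclideanSpace ℝ (Fin N)) : EuclideanSpace ℝ (Fin M) :=
  (m : ℝ)⁻¹ • ∑ j, Gc j x

/-- `∂G(x) = (1/m) ∑ⱼ ∂Gⱼ(x)`. -/
def DGbar {N M m : ℕ}
    (DG : Fin m → EuclideanSpace ℝ (Fin N) → (EuclideanSpace ℝ (Fin N) →L[ℝ] EuclideanSpace ℝ (Fin M)))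
    (x : EuclideanSpace ℝ (Fin N)) : EuclideanSpace ℝ (Fin N) →L[ℝ] EuclideanSpace ℝ (Fin M) :=
  (m : ℝ)⁻¹ • ∑ j, DG j x

/-- `∇F(y) = (1/n) ∑ᵢ ∇Fᵢ(y)`. -/
def gradFbar {M n : ℕ} (gF : Fin n → EuclideanSpace ℝ (Fin M) → EuclideanSpace ℝ (Fin M))
    (y : EuclideanSpace ℝ (Fin M)) : EuclideanSpace ℝ (Fin M) :=
  (n : ℝ)⁻¹ • ∑ i, gF i y

/-- `f(x) = F(G(x)) = (1/n) ∑ᵢ Fᵢ(G(x))`. -/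
def fObj {N M m n : ℕ} (Gc : Fin m → EuclideanSpace ℝ (Fin N) → EuclideanSpace ℝ (Fin M))
    (Fc : Fin n → EuclideanSpace ℝ (Fin M) → ℝ) (x : EuclideanSpace ℝ (Fin N)) : ℝ :=
  (n : ℝ)⁻¹ * ∑ i, Fc i (Gbar Gc x)

/-- `∇f(x) = (∂G(x))ᵀ ∇F(G(x))` (chain rule). -/
def gradf {N M m n : ℕ} (Gc : Fin m → EuclideanSpace ℝ (Fin N) → EuclideanSpace ℝ (Fin M))
    (DG : Fin m → EuclideanSpace ℝ (Fin N) → (EuclideanSpace ℝ (Fin N) →L[ℝ] EuclideanSpace ℝ (Fin M)))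
    (gF : Fin n → EuclideanSpace ℝ (Fin M) → EuclideanSpace ℝ (Fin M))
    (x : EuclideanSpace ℝ (Fin N)) : EuclideanSpace ℝ (Fin N) :=
  ContinuousLinearMap.adjoint (DGbar DG x) (gradFbar gF (Gbar Gc x))

/-- Eq. (26), pointwise form: second-moment bound on the variance-reduced
gradient estimator of Compositional-SVRG-1. -/
theorem stmt6
    (N M m n : ℕ) (hN : 0 < N) (hM : 0 < M) (hm : 0 < m) (hn : 0 < n)
    (Gc : Fin m → EuclideanSpace ℝ (Fin N) → EuclideanSpace ℝ (Fin M))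
    (DG : Fin m → EuclideanSpace ℝ (Fin N) → (EuclideanSpace ℝ (Fin N) →L[ℝ] EuclideanSpace ℝ (Fin M)))
    (hGc : ∀ j, ContDiff ℝ 1 (Gc j))
    (hDG : ∀ (j : Fin m) (x : EuclideanSpace ℝ (Fin N)), HasFDerivAt (Gc j) (DG j x) x)
    (Fc : Fin n → EuclideanSpace ℝ (Fin M) → ℝ)
    (gF : Fin n → EuclideanSpace ℝ (Fin M) → EuclideanSpace ℝ (Fin M))
    (hFc : ∀ i, ContDiff ℝ 1 (Fc i))
    (hgF : ∀ (i : Fin n) (y : EuclideanSpace ℝ (Fin M)), HasGradientAt (Fc i) (gF i y) y)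
    (BG : ℝ) (hBG : 0 < BG)
    (hBGb : ∀ (j : Fin m) (x : EuclideanSpace ℝ (Fin N)), ‖DG j x‖ ≤ BG)
    (LF : ℝ) (hLF : 0 < LF)
    (hLFb : ∀ (i : Fin n) (u v : EuclideanSpace ℝ (Fin M)), ‖gF i u - gF i v‖ ≤ LF * ‖u - v‖)
    (Lf : ℝ) (hLf : 0 < Lf)
    (hLfb : ∀ (x y : EuclideanSpace ℝ (Fin N)) (i : Fin n) (j : Fin m),
      ‖ContinuousLinearMap.adjoint (DG j x) (gF i (Gbar Gc x))
        - ContinuousLinearMap.adjoint (DG j y) (gF i (Gbar Gc y))‖ ≤ Lf * ‖x - y‖)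
 :
    ∀ (x xt : EuclideanSpace ℝ (Fin N)) (g : EuclideanSpace ℝ (Fin M)) (i : Fin n) (j : Fin m),
      ‖ContinuousLinearMap.adjoint (DG j x) (gF i g)
        - ContinuousLinearMap.adjoint (DG j xt) (gF i (Gbar Gc xt)) + gradf Gc DG gF xt‖ ^ 2
      ≤ 2 * ‖gradf Gc DG gF xt‖ ^ 2 + 4 * BG ^ 2 * LF ^ 2 * ‖g - Gbar Gc x‖ ^ 2
        + 4 * Lf ^ 2 * ‖x - xt‖ ^ 2 := by
  intro x xt g i j
  have h1 : ‖ContinuousLinearMap.adjoint (DG j x) (gF i g)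
      - ContinuousLinearMap.adjoint (DG j x) (gF i (Gbar Gc x))‖
      ≤ BG * (LF * ‖g - Gbar Gc x‖) := by
    rw [← map_sub]
    refine (ContinuousLinearMap.le_opNorm _ _).trans ?_
    rw [LinearIsometryEquiv.norm_map]
    exact mul_le_mul (hBGb j x) (hLFb i _ _) (norm_nonneg _) hBG.le
  have h2 := hLfb x xt i j
  generalize ContinuousLinearMap.adjoint (DG j x) (gF i g) = a at *
  generalize ContinuousLinearMap.adjoint (DG j x) (gF i (Gbar Gc x)) = b at *
  generalize ContinuousLinearMap.adjoint (DG j xt) (gF i (Gbar Gc xt)) = c at *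
  generalize gradf Gc DG gF xt = d at *
  have h3 : ‖a - c + d‖ ≤ BG * (LF * ‖g - Gbar Gc x‖) + Lf * ‖x - xt‖ + ‖d‖ := by
    have e : a - c + d = (a - b) + (b - c) + d := by abel
    rw [e]
    exact (norm_add₃_le).trans (by linarith)
  have h4 := pow_le_pow_left₀ (norm_nonneg _) h3 2
  generalize ‖g - Gbar Gc x‖ = p at *
  generalize ‖x - xt‖ = q at *
  nlinarith [sq_nonneg (BG * (LF * p) + Lf * q - ‖d‖), sq_nonneg (BG * (LF * p) - Lf * q)]
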